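/- arXiv:1908.09483 — 2 statements merged into one kernel-verified Lean document; each statement's English description precedes it below -/
import Mathlib

section
/- Let n₀ ≥ 1 be such that f_{n+1} < 4·p_n for all n ≥ n₀. Then every even number x > 2 with x > f_{n₀} can be written as x = p + q with prime numbers p ≤ q such that x/4 < p ≤ x/2 (equivalently, x < 4·p and 2·p ≤ x). -/
open Filter Pointwise

/-- `nthPrime n` is the `n`-th prime number (1-indexed): `nthPrime 1 = 2`, etc. -/
noncomputable def nthPrime (n : ℕ) : ℕ := Nat.nth Nat.Prime (n - 1)

/-- `S n` is the additive submonoid of `ℕ` generated by the primes `q ≥ nthPrime n`. -/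
def S (n : ℕ) : AddSubmonoid ℕ :=
  AddSubmonoid.closure {q : ℕ | q.Prime ∧ nthPrime n ≤ q}

/-- `frob n` is the Frobenius number of `S n`: the largest natural number not in `S n`. -/
noncomputable def frob (n : ℕ) : ℕ := sSup {m : ℕ | m ∉ S n}

/-- `genus n` is the number of natural numbers not in `S n`. -/
noncomputable def genus (n : ℕ) : ℕ := {m : ℕ | m ∉ S n}.ncard

/-- `atoms n` is the minimal generating set `S n \ {0} \ ((S n \ {0}) + (S n \ {0}))`. -/
def atoms (n : ℕ) : Set ℕ :=
  ((S n : Set ℕ) \ {0}) \ (((S n : Set ℕ) \ {0}) + ((S n : Set ℕ) \ {0}))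

/-- `u n` is the largest atom of `S n`. -/
noncomputable def u (n : ℕ) : ℕ := sSup (atoms n)

/-- `e n` is the embedding dimension of `S n`: the number of atoms. -/
noncomputable def e (n : ℕ) : ℕ := (atoms n).ncard

theorem nthPrime_prime (n : ℕ) : (nthPrime n).Prime := Nat.prime_nth_prime _

/-- A member of `S n` is a sum of primes `≥ nthPrime n`, which bounds the number of summands. -/
theorem exists_multiset_of_mem_S {n x : ℕ} (hx : x ∈ S n) :
    ∃ s : Multiset ℕ, (∀ q ∈ s, q.Prime ∧ nthPrime n ≤ q) ∧ s.sum = x ∧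
      s.card * nthPrime n ≤ x := by
  obtain ⟨s, hs, rfl⟩ := AddSubmonoid.exists_multiset_of_mem_closure hx
  refine ⟨s, hs, rfl, ?_⟩
  simpa using Multiset.card_nsmul_le_sum (fun q hq => (hs q hq).2)

theorem bddAbove_compl_S (n : ℕ) : BddAbove {m : ℕ | m ∉ S n} := by
  obtain ⟨q, hq, hqp⟩ := Nat.exists_infinite_primes (nthPrime n + 1)
  have hp := nthPrime_prime n
  have hcop : Nat.Coprime (nthPrime n) q := (Nat.coprime_primes hp hqp).2 (by omega)
  refine (frobeniusNumber_pair hcop hp.one_lt hqp.one_lt).bddAbove.mono ?_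
  intro m hm hmem
  refine hm ?_
  refine AddSubmonoid.closure_mono ?_ hmem
  rintro r (rfl | rfl)
  · exact ⟨hp, le_rfl⟩
  · exact ⟨hqp, by omega⟩

theorem mem_S_of_frob_lt {n x : ℕ} (hx : frob n < x) : x ∈ S n := by
  by_contra hmem
  exact absurd (le_csSup (bddAbove_compl_S n) hmem) (not_le.2 hx)

theorem nthPrime_le_frob_add_one (n : ℕ) : nthPrime n ≤ frob n + 1 := by
  by_contra! hlt
  obtain ⟨s, -, hsum, hcard⟩ :=
    exists_multiset_of_mem_S (mem_S_of_frob_lt (n := n) (x := nthPrime n - 1) (by omega))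
  have h2 := (nthPrime_prime n).two_le
  rcases Nat.eq_zero_or_pos s.card with h0 | h0
  · rw [Multiset.card_eq_zero] at h0
    subst h0
    simp at hsum
    omega
  · have := Nat.le_mul_of_pos_left (nthPrime n) h0
    omega

theorem exists_frob_lt_le {n₀ x : ℕ} (hx : frob n₀ < x) :
    ∃ n ≥ n₀, frob n < x ∧ x ≤ frob (n + 1) := by
  by_contra! hstep
  have hall : ∀ n ≥ n₀, frob n < x := fun n hn =>
    Nat.le_induction hx (fun m hm ih => hstep m hm ih) n hn
  have h1 := hall (n₀ + x + 1) (by omega)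
  have h2 := nthPrime_le_frob_add_one (n₀ + x + 1)
  have h3 : n₀ + x + 1 - 1 + 2 ≤ nthPrime (n₀ + x + 1) := Nat.add_two_le_nth_prime _
  omega

theorem lemma1 (n₀ : ℕ) (hn₀ : 1 ≤ n₀)
    (h : ∀ n ≥ n₀, frob (n + 1) < 4 * nthPrime n) :
    ∀ x : ℕ, Even x → 2 < x → frob n₀ < x →
    ∃ p q : ℕ, p.Prime ∧ q.Prime ∧ p ≤ q ∧ x = p + q ∧
      x < 4 * p ∧ 2 * p ≤ x := by
  intro x hx h2 hfx
  obtain ⟨n, hn, hlt, hle⟩ := exists_frob_lt_le hfx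
  have hx4 : x < 4 * nthPrime n := hle.trans_lt (h n hn)
  obtain ⟨s, hs, hsum, hcard⟩ := exists_multiset_of_mem_S (mem_S_of_frob_lt hlt)
  have hc : s.card < 4 := lt_of_mul_lt_mul_right (hcard.trans_lt hx4) (Nat.zero_le _)
  obtain hc | hc | hc | hc : s.card = 0 ∨ s.card = 1 ∨ s.card = 2 ∨ s.card = 3 := by omega
  · rw [Multiset.card_eq_zero] at hc
    subst hc
    simp at hsum
    omega
  · obtain ⟨a, rfl⟩ := Multiset.card_eq_one.1 hc
    obtain rfl : a = x := by simpa using hsum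
    have := (hs a (by simp)).1.even_iff.1 hx
    omega
  · obtain ⟨a, b, rfl⟩ := Multiset.card_eq_two.1 hc
    have hab : a + b = x := by simpa using hsum
    obtain ⟨ha, hna⟩ := hs a (by simp)
    obtain ⟨hb, hnb⟩ := hs b (by simp)
    rcases le_total a b with hle | hle
    · exact ⟨a, b, ha, hb, hle, by omega, by omega, by omega⟩
    · exact ⟨b, a, hb, ha, hle, by omega, by omega, by omega⟩
  · obtain ⟨a, b, c, rfl⟩ := Multiset.card_eq_three.1 hc
    have habc : a + (b + c) = x := by simpa [add_assoc] using hsum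
    obtain ⟨ha, hna⟩ := hs a (by simp)
    obtain ⟨hb, hnb⟩ := hs b (by simp)
    obtain ⟨hc, hnc⟩ := hs c (by simp)
    have hp2 : nthPrime n ≤ 2 := by
      rcases ha.eq_two_or_odd with h | h
      · omega
      rcases hb.eq_two_or_odd with h | h
      · omega
      rcases hc.eq_two_or_odd with h | h
      · omega
      have := Nat.even_iff.1 hx
      omega
    obtain rfl | rfl : x = 4 ∨ x = 6 := by
      have := Nat.even_iff.1 hx
      omega
    · exact ⟨2, 2, by norm_num⟩
    · exact ⟨3, 3, by norm_num⟩
end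

section
/- For every n ≥ 429, the Frobenius number satisfies f_n < n². -/
open Filter Pointwise

/-- Iterating Cauchy–Davenport: sums of `k` elements of `insert 0 B` reach at least
`min Q (k * #B + 1)` residue classes modulo the prime `Q`. -/
lemma exists_residues_of_subset_submonoid {Q : ℕ} (hQ : Q.Prime) (H : AddSubmonoid ℕ)
    (B : Finset ℕ) (hB : ∀ b ∈ B, b ∈ H ∧ 0 < b ∧ b < Q) (k : ℕ) :
    ∃ C : Finset (ZMod Q), min Q (k * B.card + 1) ≤ C.card ∧
      ∀ c ∈ C, ∃ h ∈ H, h ≤ k * (Q - 1) ∧ (h : ZMod Q) = c := by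
  induction k with
  | zero => exact ⟨{0}, by simp, fun c hc => ⟨0, H.zero_mem, by simp, by simp_all⟩⟩
  | succ k ih =>
    obtain ⟨C, hC, hCH⟩ := ih
    set A : Finset (ZMod Q) := (insert 0 B).image (fun b : ℕ => (b : ZMod Q)) with hA
    have hlt : ∀ b ∈ insert 0 B, b < Q := by
      intro b hb
      rcases Finset.mem_insert.1 hb with rfl | hb
      · exact hQ.pos
      · exact (hB b hb).2.2
    have hcard : A.card = B.card + 1 := by
      rw [hA, Finset.card_image_of_injOn, Finset.card_insert_of_notMem]
      · exact fun h => (hB 0 h).2.1.false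
      · intro a ha b hb hab
        have := (ZMod.natCast_eq_natCast_iff' a b Q).1 hab
        rwa [Nat.mod_eq_of_lt (hlt a ha), Nat.mod_eq_of_lt (hlt b hb)] at this
    have hCne : C.Nonempty := by
      rw [← Finset.card_pos]
      exact lt_of_lt_of_le (lt_min hQ.pos (Nat.succ_pos _)) hC
    have hAne : A.Nonempty := by
      rw [← Finset.card_pos]
      omega
    refine ⟨C + A, ?_, ?_⟩
    · have := ZMod.cauchy_davenport hQ hCne hAne
      rw [hcard] at this
      rw [Nat.add_mul, Nat.one_mul]
      omega
    · intro c hc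
      obtain ⟨x, hx, y, hy, rfl⟩ := Finset.mem_add.1 hc
      obtain ⟨h, hh, hle, rfl⟩ := hCH x hx
      obtain ⟨b, hb, rfl⟩ := Finset.mem_image.1 hy
      have hbH : b ∈ H := by
        rcases Finset.mem_insert.1 hb with rfl | hb
        · exact H.zero_mem
        · exact (hB b hb).1
      refine ⟨h + b, H.add_mem hh hbH, ?_, by push_cast; rfl⟩
      have := hlt b hb
      rw [Nat.add_mul, Nat.one_mul]
      omega

lemma mem_submonoid_of_mul_le {Q : ℕ} (hQ : Q.Prime) (H : AddSubmonoid ℕ) (hQH : Q ∈ H)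
    (B : Finset ℕ) (hB : ∀ b ∈ B, b ∈ H ∧ 0 < b ∧ b < Q) {k m : ℕ}
    (hk : Q - 1 ≤ k * B.card) (hm : k * (Q - 1) ≤ m) : m ∈ H := by
  obtain ⟨C, hC, hCH⟩ := exists_residues_of_subset_submonoid hQ H B hB k
  have : NeZero Q := ⟨hQ.ne_zero⟩
  have hCuniv : C = Finset.univ := by
    rw [← Finset.card_eq_iff_eq_univ, ZMod.card]
    have := Finset.card_le_univ C
    rw [ZMod.card] at this
    omega
  obtain ⟨h, hh, hle, hmod⟩ := hCH (m : ZMod Q) (by simp [hCuniv])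
  have hdvd := (Nat.modEq_iff_dvd' (hle.trans hm)).1 ((ZMod.natCast_eq_natCast_iff h m Q).1 hmod)
  obtain ⟨t, ht⟩ := hdvd
  have hmt : m = h + t • Q := by
    rw [smul_eq_mul, Nat.mul_comm, ← ht]
    omega
  rw [hmt]
  exact H.add_mem hh (H.nsmul_mem hQH t)

lemma frob_lt_sq_of_prime {n k Q : ℕ} (hn : 0 < n) (hQ : Q.Prime)
    (hk : Q - 1 ≤ k * (Nat.count Nat.Prime Q + 1 - n)) (hkn : k * (Q - 1) ≤ n ^ 2) :
    frob n < n ^ 2 := by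
  have hcount : n - 1 < Nat.count Nat.Prime Q := by
    by_contra! h
    have : Nat.count Nat.Prime Q + 1 - n = 0 := by omega
    rw [this, Nat.mul_zero] at hk
    have := hQ.two_le
    omega
  have hlt : nthPrime n < Q := Nat.nth_lt_of_lt_count hcount
  have hS : ∀ q, q.Prime → nthPrime n ≤ q → q ∈ S n := fun q hq h =>
    AddSubmonoid.subset_closure ⟨hq, h⟩
  let B := (Finset.range Q).filter Nat.Prime \ (Finset.range (nthPrime n)).filter Nat.Prime
  have hcard : B.card = Nat.count Nat.Prime Q + 1 - n := by
    rw [Finset.card_sdiff_of_subset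
      (Finset.filter_subset_filter _ (Finset.range_subset_range.2 hlt.le)),
      ← Nat.count_eq_card_filter_range, ← Nat.count_eq_card_filter_range, nthPrime,
      Nat.count_nth_of_infinite Nat.infinite_setOfPred_prime]
    omega
  have hB : ∀ b ∈ B, b ∈ S n ∧ 0 < b ∧ b < Q := by
    intro b hb
    simp only [B, Finset.mem_sdiff, Finset.mem_filter, Finset.mem_range, not_and'] at hb
    exact ⟨hS b hb.1.2 (not_lt.1 (hb.2 hb.1.2)), hb.1.2.pos, hb.1.1⟩
  have hmem : ∀ m, n ^ 2 ≤ m → m ∈ S n := fun m hm =>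
    mem_submonoid_of_mul_le hQ (S n) (hS Q hQ hlt.le) B hB (hcard ▸ hk) (hkn.trans hm)
  rcases Set.eq_empty_or_nonempty {m : ℕ | m ∉ S n} with h | h
  · simp only [frob, h, csSup_empty, Nat.bot_eq_zero]
    positivity
  · have hbdd : BddAbove {m : ℕ | m ∉ S n} :=
      ⟨n ^ 2, fun m hm => not_lt.1 fun hlt => hm (hmem m hlt.le)⟩
    exact not_le.1 fun hle => Nat.sSup_mem h hbdd (hmem _ hle)

/-- The number of `m` with `a ≤ m < a + 2 ^ d` coprime to `P`, computed by bisection. -/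
def countCoprime (P : ℕ) : ℕ → ℕ → ℕ
  | 0, a => if Nat.gcd a P = 1 then 1 else 0
  | d + 1, a => countCoprime P d a + countCoprime P d (a + 2 ^ d)

lemma countCoprime_eq_card (P d a : ℕ) :
    countCoprime P d a = ((Finset.Ico a (a + 2 ^ d)).filter (Nat.Coprime · P)).card := by
  induction d generalizing a with
  | zero => simp [countCoprime, Finset.filter_singleton, Nat.Coprime, apply_ite Finset.card]
  | succ d ih =>
    rw [countCoprime, ih, ih, ← Finset.card_union_of_disjoint, ← Finset.filter_union,
      Finset.Ico_union_Ico_eq_Ico (Nat.le_add_right _ _) (Nat.le_add_right _ _), pow_succ,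
      Nat.mul_two, Nat.add_assoc]
    exact Finset.disjoint_filter_filter (Finset.Ico_disjoint_Ico_consecutive _ _ _)

lemma prime_of_coprime_factorial {b m : ℕ} (hm : 1 < m) (hlt : m < (b + 1) ^ 2)
    (h : m.Coprime b.factorial) : m.Prime := by
  by_contra hp
  have hsq : m.minFac ^ 2 ≤ m := Nat.minFac_sq_le_self (by omega) hp
  have hle : m.minFac < b + 1 := lt_of_pow_lt_pow_left₀ 2 (by omega) (hsq.trans_lt hlt)
  have hdvd : m.minFac ∣ b.factorial := Nat.dvd_factorial m.minFac_pos (by omega)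
  exact (Nat.minFac_prime hm.ne').not_dvd_one (h.gcd_eq_one ▸ Nat.dvd_gcd m.minFac_dvd hdvd)

lemma countCoprime_factorial_le {b d Q : ℕ} (hd : 2 ^ d ≤ (b + 1) ^ 2) (hQ : 2 ^ d ≤ Q)
    (hb : 2 ≤ b) : countCoprime b.factorial d 0 ≤ Nat.count Nat.Prime Q + 1 := by
  rw [countCoprime_eq_card, Nat.count_eq_card_filter_range]
  refine (Finset.card_le_card (t := insert 1 ((Finset.range Q).filter Nat.Prime)) ?_).trans
    (Finset.card_insert_le _ _)
  intro m hm
  simp only [Finset.mem_filter, Finset.mem_Ico, Nat.zero_add] at hm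
  obtain ⟨⟨-, hlt⟩, hco⟩ := hm
  rcases Nat.lt_trichotomy m 1 with h | h | h
  · obtain rfl : m = 0 := by omega
    have : 2 ∣ b.factorial := Nat.dvd_factorial two_pos hb
    rw [Nat.coprime_zero_left] at hco
    omega
  · simp [h]
  · simp [prime_of_coprime_factorial h (hlt.trans_le hd) hco, hlt.trans_le hQ]

lemma count_prime_8209 : 990 ≤ Nat.count Nat.Prime 8209 := by
  have h : 991 ≤ countCoprime (Nat.factorial 90) 13 0 := by decide +kernel
  have := countCoprime_factorial_le (b := 90) (d := 13) (Q := 8209) (by norm_num) (by norm_num)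
    (by norm_num)
  omega

lemma count_prime_16411 : 1860 ≤ Nat.count Nat.Prime 16411 := by
  have h : 1861 ≤ countCoprime (Nat.factorial 127) 14 0 := by decide +kernel
  have := countCoprime_factorial_le (b := 127) (d := 14) (Q := 16411) (by norm_num) (by norm_num)
    (by norm_num)
  omega

/-- Chebyshev's lower bound, in the form needed for the `2n`-th prime. -/
lemma sq_add_mul_le_cube {n Q : ℕ} (hn : 1600 ≤ n) (hQ : 0 < Q)
    (h : Nat.primeCounting Q ≤ 2 * n) : Q ^ 2 + n * Q ≤ n ^ 3 := by
  have h₁ := (Chebyshev.psi_ge Q).trans (Chebyshev.psi_le_primeCounting_mul_log Q)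
  have hQ1 : (1 : ℝ) ≤ Q := by exact_mod_cast hQ
  have hlog0 : 0 ≤ Real.log Q := Real.log_nonneg hQ1
  have hπ : (Nat.primeCounting Q : ℝ) ≤ 2 * n := by exact_mod_cast h
  have h₂ : Q * Real.log 2 - Real.log (Q + 1) ≤ 2 * n * Real.log Q :=
    h₁.trans (mul_le_mul_of_nonneg_right hπ hlog0)
  have h₃ : Real.log (Q + 1) ≤ Real.log Q + 1 := by
    have : Real.log ((Q : ℝ) + 1) ≤ Real.log (2 * Q) :=
      Real.log_le_log (by positivity) (by linarith)
    rw [Real.log_mul (by norm_num) (by positivity)] at this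
    linarith [Real.log_two_lt_d9]
  by_contra! hcon
  set s : ℝ := √n with hs
  have hs2 : s ^ 2 = n := Real.sq_sqrt (Nat.cast_nonneg n)
  have hs40 : 40 ≤ s := by
    rw [hs]
    apply Real.le_sqrt_of_sq_le
    have : (1600 : ℝ) ≤ n := by exact_mod_cast hn
    linarith
  have hcon' : s ^ 6 < (Q : ℝ) ^ 2 + s ^ 2 * Q := by
    have : ((n : ℝ)) ^ 3 < (Q : ℝ) ^ 2 + n * Q := by exact_mod_cast hcon
    rw [← hs2] at this
    linarith [this, pow_mul s 2 3]
  have hQs : s ^ 3 - s ^ 2 / 2 - 1 ≤ Q := by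
    by_contra! hlt
    nlinarith [mul_pos (show (0 : ℝ) < s ^ 3 by positivity) (show (0 : ℝ) < s ^ 2 by positivity),
      pow_le_pow_left₀ (by norm_num) hs40 2, pow_le_pow_left₀ (by norm_num) hs40 3]
  have hlogQ : Real.log Q ≤ 3 * Real.log s + Q / s ^ 3 - 1 := by
    have h := Real.log_le_sub_one_of_pos (show (0 : ℝ) < Q / s ^ 3 by positivity)
    rw [Real.log_div (by positivity) (by positivity), Real.log_pow] at h
    push_cast at h
    linarith
  have hlogs : Real.log s ≤ 2.72 + s / 40 := by
    have h := Real.log_le_sub_one_of_pos (show (0 : ℝ) < s / 40 by positivity)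
    have h5 := Real.log_le_sub_one_of_pos (show (0 : ℝ) < 5 / 4 by norm_num)
    have h40 : Real.log 40 = 5 * Real.log 2 + Real.log (5 / 4) := by
      rw [← Real.log_rpow (by norm_num), ← Real.log_mul (by norm_num) (by norm_num)]
      norm_num
    rw [Real.log_div (by positivity) (by positivity)] at h
    linarith [Real.log_two_lt_d9]
  have hinv : (Q : ℝ) / s ^ 3 * (2 * s ^ 2 + 1) ≤ Q * 0.0501 := by
    rw [div_mul_eq_mul_div, div_le_iff₀ (by positivity), mul_assoc]
    apply mul_le_mul_of_nonneg_left _ (Nat.cast_nonneg Q)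
    nlinarith [pow_le_pow_left₀ (by norm_num) hs40 2]
  have hmain : (Q : ℝ) * 0.693 ≤ (2 * s ^ 2 + 1) * (7.16 + 0.075 * s + Q / s ^ 3) + 1 := by
    have h₄ : (2 * s ^ 2 + 1) * Real.log Q ≤ (2 * s ^ 2 + 1) * (7.16 + 0.075 * s + Q / s ^ 3) :=
      mul_le_mul_of_nonneg_left (by linarith) (by positivity)
    rw [← hs2] at h₂
    nlinarith [Real.log_two_gt_d9]
  nlinarith [pow_le_pow_left₀ (by norm_num) hs40 2,
    mul_nonneg (sub_nonneg.2 hs40) (sq_nonneg s)]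

theorem frob_lt_sq (n : ℕ) (hn : 429 ≤ n) : frob n < n ^ 2 := by
  rcases le_or_gt 1600 n with h | h
  · set Q := Nat.nth Nat.Prime (2 * n - 1) with hQdef
    have hQ : Q.Prime := Nat.prime_nth_prime _
    have hcount : Nat.count Nat.Prime Q = 2 * n - 1 :=
      Nat.count_nth_of_infinite Nat.infinite_setOfPred_prime _
    have hπ : Nat.primeCounting Q = 2 * n := by
      rw [Nat.primeCounting, Nat.primeCounting', Nat.count_succ, hcount, if_pos hQ]
      omega
    have hcube := sq_add_mul_le_cube h hQ.pos hπ.le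
    have hle : Q - 1 ≤ n * ((Q - 1) / n + 1) := (Nat.lt_mul_div_succ (Q - 1) (by omega)).le
    refine frob_lt_sq_of_prime (k := (Q - 1) / n + 1) (by omega) hQ ?_ ?_
    · rw [hcount, show 2 * n - 1 + 1 - n = n by omega, Nat.mul_comm]
      exact hle
    · have hdiv : n * ((Q - 1) / n) ≤ Q := (Nat.mul_div_le _ _).trans (Nat.sub_le _ _)
      refine Nat.le_of_mul_le_mul_left (c := n) ?_ (by omega)
      calc n * (((Q - 1) / n + 1) * (Q - 1))
          = (n * ((Q - 1) / n) + n) * (Q - 1) := by ring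
        _ ≤ (Q + n) * Q := Nat.mul_le_mul (by omega) (Nat.sub_le _ _)
        _ = Q ^ 2 + n * Q := by ring
        _ ≤ n * n ^ 2 := hcube.trans_eq (by ring)
  have h₁ := count_prime_8209
  have h₂ := count_prime_16411
  rcases lt_or_ge n 617 with h' | h'
  · exact frob_lt_sq_of_prime (k := 22) (Q := 8209) (by omega) (by norm_num) (by omega)
      (by nlinarith)
  rcases lt_or_ge n 1147 with h'' | h''
  · exact frob_lt_sq_of_prime (k := 23) (Q := 16411) (by omega) (by norm_num) (by omega)
      (by nlinarith)
  · exact frob_lt_sq_of_prime (k := 80) (Q := 16411) (by omega) (by norm_num) (by omega)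
      (by nlinarith)
end
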